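/- arXiv:0806.2928 — 2 statements merged into one kernel-verified Lean document; each statement's English description precedes it below -/
import Mathlib

section
/- Let (X,r) be a nondegenerate quadratic set satisfying condition lri and satisfying ^{(x^y)}z = ˣz for all x,y,z ∈ X, and let f(x,y) = (ˣy, x). Then the following are equivalent: (i) r satisfies the Yang–Baxter equation; (ii) the left actions pairwise commute, L_x ∘ L_y = L_y ∘ L_x for all x,y ∈ X; (iii) f satisfies the Yang–Baxter equation. -/
namespace YB

variable {X : Type*}

/-- The left action `ˣy` of a quadratic map `r`. -/
def la (r : X × X → X × X) (x y : X) : X := (r (x, y)).1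

/-- The right action `x^y` of a quadratic map `r`; `ra r y` is the map `R_y`. -/
def ra (r : X × X → X × X) (y x : X) : X := (r (x, y)).2

/-- Nondegeneracy: all left and right actions are bijective. -/
def Nondeg (r : X × X → X × X) : Prop :=
  (∀ x, Function.Bijective (la r x)) ∧ (∀ y, Function.Bijective (ra r y))

/-- Square-free: `r(x,x) = (x,x)`. -/
def SqFree (r : X × X → X × X) : Prop := ∀ x, r (x, x) = (x, x)

/-- Involutive: `r ∘ r = id`. -/
def Invol (r : X × X → X × X) : Prop := ∀ p, r (r p) = p

/-- `r` acting in positions 1,2 of `X × X × X`. -/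
def m12 (F : X × X → X × X) : X × X × X → X × X × X :=
  fun p => ((F (p.1, p.2.1)).1, (F (p.1, p.2.1)).2, p.2.2)

/-- `r` acting in positions 2,3 of `X × X × X`. -/
def m23 (F : X × X → X × X) : X × X × X → X × X × X :=
  fun p => (p.1, F (p.2.1, p.2.2))

/-- The Yang–Baxter equation for a map `X × X → X × X`. -/
def YBE (F : X × X → X × X) : Prop :=
  m12 F ∘ m23 F ∘ m12 F = m23 F ∘ m12 F ∘ m23 F

/-- The permutation group `𝒢(X,r)`: the subgroup of `Sym(X)` generated by the
left actions `L_x`. -/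
def Gcal (r : X × X → X × X) : Subgroup (Equiv.Perm X) :=
  Subgroup.closure {g : Equiv.Perm X | ∃ x, (g : X → X) = la r x}


/-- Condition **lri**: `(ˣy)ˣ = y = ˣ(yˣ)`. -/
def Lri (r : X × X → X × X) : Prop :=
  ∀ x y, ra r x (la r x y) = y ∧ la r x (ra r x y) = y

/-- The map `f(x,y) = (ˣy, x)`. -/
def fmap (r : X × X → X × X) : X × X → X × X := fun p => ((r p).1, p.1)

theorem la_la_left {r : X × X → X × X} (hlri : Lri r)
    (ha : ∀ x y z : X, la r (r (x, y)).2 z = la r x z) (x y z : X) :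
    la r (la r x y) z = la r y z := by
  have h := ha (la r x y) x z
  have e : (r (la r x y, x)).2 = y := (hlri x y).1
  rw [e] at h
  exact h.symm

theorem Lri.ra_eq_of_la_eq {r : X × X → X × X} (hlri : Lri r) {x y : X}
    (h : ∀ z, la r x z = la r y z) (z : X) : ra r x z = ra r y z := by
  have e := (hlri x (ra r y z)).1
  rwa [h, (hlri y z).2] at e

theorem Lri.ra_comm_la {r : X × X → X × X} (hlri : Lri r)
    (hc : ∀ x y z : X, la r x (la r y z) = la r y (la r x z)) (x y z : X) :
    ra r x (la r y z) = la r y (ra r x z) := by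
  have e := (hlri x (la r y (ra r x z))).1
  rwa [hc, (hlri x z).2] at e

theorem Lri.ra_comm_ra {r : X × X → X × X} (hlri : Lri r)
    (hc : ∀ x y z : X, la r x (la r y z) = la r y (la r x z)) (x y z : X) :
    ra r x (ra r y z) = ra r y (ra r x z) := by
  have e := (hlri y (ra r x (ra r y z))).1
  rw [← hlri.ra_comm_la hc, (hlri y z).2] at e
  exact e.symm

theorem ybe_iff {r : X × X → X × X} (hlri : Lri r)
    (ha : ∀ x y z : X, la r (r (x, y)).2 z = la r x z) :
    YBE r ↔ ∀ x y z : X, la r y (la r x z) = la r x (la r y z) ∧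
      ra r z (la r x y) = la r x (ra r z y) ∧
      ra r z (ra r y x) = ra r y (ra r z x) := by
  have hl := la_la_left hlri ha
  have ha' : ∀ x y z : X, la r (ra r y x) z = la r x z := ha
  have hrl : ∀ x y z : X, ra r (la r x y) z = ra r y z := fun x y =>
    hlri.ra_eq_of_la_eq (hl x y)
  have hrr : ∀ x y z : X, ra r (ra r y x) z = ra r x z := fun x y =>
    hlri.ra_eq_of_la_eq (ha' x y)
  have hr : ∀ x y, r (x, y) = (la r x y, ra r y x) := fun _ _ => rfl
  simp only [YBE, funext_iff, Prod.forall, Function.comp_apply, m12, m23, hr,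
    Prod.mk.injEq, hl, ha', hrl, hrr]

theorem ybe_fmap_iff {r : X × X → X × X} (hlri : Lri r)
    (ha : ∀ x y z : X, la r (r (x, y)).2 z = la r x z) :
    YBE (fmap r) ↔ ∀ x y z : X, la r y (la r x z) = la r x (la r y z) := by
  have hl := la_la_left hlri ha
  have hf : ∀ x y, fmap r (x, y) = (la r x y, x) := fun _ _ => rfl
  simp only [YBE, funext_iff, Prod.forall, Function.comp_apply, m12, m23, hf,
    Prod.mk.injEq, hl, and_true]

/-- for a nondegenerate quadratic set with **lri** satisfying
`^{(x^y)}z = ˣz`, the following are equivalent: (i) `r` obeys the YBE,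
(ii) the left actions pairwise commute, (iii) `f` obeys the YBE. -/
theorem stmt17 (r : X × X → X × X) (hbij : Function.Bijective r) (hnd : Nondeg r)
    (hlri : Lri r) (ha : ∀ x y z : X, la r (r (x, y)).2 z = la r x z) :
    (YBE r ↔ ∀ x y : X, la r x ∘ la r y = la r y ∘ la r x) ∧
    ((∀ x y : X, la r x ∘ la r y = la r y ∘ la r x) ↔ YBE (fmap r)) := by
  rw [ybe_iff hlri ha, ybe_fmap_iff hlri ha]
  simp only [funext_iff, Function.comp_apply]
  refine ⟨⟨fun h x y z => (h y x z).1, fun hc x y z => ⟨hc y x z, ?_, ?_⟩⟩,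
    fun hc x y z => hc y x z, fun hc x y z => hc y x z⟩
  · exact hlri.ra_comm_la hc z x y
  · exact hlri.ra_comm_ra hc z y x

end YB
end

section
/- Let (X,r) be a nondegenerate square-free symmetric set (so that condition lri holds). Then the following are equivalent: (i) ^{(ʸx)}z = ^{(ʸ'x)}z for all x,y,y',z ∈ X (i.e. the retraction of (X,r) has all left actions equal, so (X,r) has multipermutation level at most 2); (ii) ^{(ʸx)}z = ˣz for all x,y,z ∈ X; (iii) ^{(x^y)}z = ˣz for all x,y,z ∈ X. -/
namespace YB

variable {X : Type*}

/-- First component of the Yang–Baxter equation: `L_x L_y = L_{ˣy} L_{x^y}`. -/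
theorem YBE.la_la {r : X × X → X × X} (h : YBE r) (x y z : X) :
    la r (la r x y) (la r (ra r y x) z) = la r x (la r y z) :=
  congrArg (fun p : X × X × X => p.1) (congrFun h (x, y, z))

/-- Third component of the Yang–Baxter equation: `R_z R_y = R_{y^z} R_{ʸz}`. -/
theorem YBE.ra_ra {r : X × X → X × X} (h : YBE r) (x y z : X) :
    ra r z (ra r y x) = ra r (ra r z y) (ra r (la r y z) x) :=
  congrArg (fun p => p.2.2) (congrFun h (x, y, z))

theorem SqFree.la_self {r : X × X → X × X} (h : SqFree r) (x : X) : la r x x = x :=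
  congrArg Prod.fst (h x)

theorem SqFree.ra_self {r : X × X → X × X} (h : SqFree r) (x : X) : ra r x x = x :=
  congrArg Prod.snd (h x)

theorem Invol.la_la_ra {r : X × X → X × X} (h : Invol r) (x y : X) :
    la r (la r x y) (ra r y x) = x :=
  congrArg Prod.fst (h (x, y))

theorem Invol.ra_ra_la {r : X × X → X × X} (h : Invol r) (x y : X) :
    ra r (ra r y x) (la r x y) = y :=
  congrArg Prod.snd (h (x, y))

/-- The left cyclic condition `^{(y^x)}x = ʸx`. -/
theorem la_ra_eq_la {r : X × X → X × X} (hnd : Nondeg r) (hsf : SqFree r) (hybe : YBE r)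
    (x y : X) : la r (ra r x y) x = la r y x := by
  apply (hnd.1 (la r y x)).1
  rw [hybe.la_la, hsf.la_self, hsf.la_self]

/-- The right cyclic condition `x^{(ˣy)} = x^y`. -/
theorem ra_la_eq_ra {r : X × X → X × X} (hnd : Nondeg r) (hsf : SqFree r) (hybe : YBE r)
    (x y : X) : ra r (la r x y) x = ra r y x := by
  apply (hnd.2 (ra r y x)).1
  rw [← hybe.ra_ra, hsf.ra_self, hsf.ra_self]

/-- The first half of condition lri: `(ˣy)ˣ = y`. -/
theorem ra_la_cancel {r : X × X → X × X} (hnd : Nondeg r) (hsf : SqFree r) (hinv : Invol r)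
    (hybe : YBE r) (x y : X) : ra r x (la r x y) = y := by
  have h := ra_la_eq_ra hnd hsf hybe (la r x y) (ra r y x)
  rwa [hinv.la_la_ra, hinv.ra_ra_la] at h

/-- The second half of condition lri: `ˣ(yˣ) = y`. -/
theorem la_ra_cancel {r : X × X → X × X} (hnd : Nondeg r) (hsf : SqFree r) (hinv : Invol r)
    (hybe : YBE r) (x y : X) : la r x (ra r x y) = y := by
  have h := la_ra_eq_la hnd hsf hybe (ra r x y) (la r y x)
  rwa [hinv.ra_ra_la, hinv.la_la_ra] at h

/-- for a nondegenerate square-free symmetric set, the following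
are equivalent: (i) `^{(ʸx)}z = ^{(ʸ'x)}z` for all `x,y,y',z` (the retraction
has all left actions equal, i.e. multipermutation level ≤ 2);
(ii) `^{(ʸx)}z = ˣz`; (iii) `^{(x^y)}z = ˣz`. -/
theorem stmt18 (r : X × X → X × X) (hbij : Function.Bijective r)
    (hnd : Nondeg r) (hsf : SqFree r) (hinv : Invol r) (hybe : YBE r) :
    ((∀ x y y' z : X, la r (la r y x) z = la r (la r y' x) z) ↔
      (∀ x y z : X, la r (la r y x) z = la r x z)) ∧
    ((∀ x y z : X, la r (la r y x) z = la r x z) ↔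
      (∀ x y z : X, la r (r (x, y)).2 z = la r x z)) := by
  refine ⟨⟨fun h x y z => ?_, fun h x y y' z => (h x y z).trans (h x y' z).symm⟩,
    fun h x y z => ?_, fun h x y z => ?_⟩
  · rw [h x y x z, hsf.la_self]
  · change la r (ra r y x) z = la r x z
    rw [← h (ra r y x) y z, la_ra_cancel hnd hsf hinv hybe]
  · have h' : la r (ra r y (la r y x)) z = la r (la r y x) z := h (la r y x) y z
    rw [← h', ra_la_cancel hnd hsf hinv hybe]

end YB
end
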